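/- The function G is differentiable at each θ₂ ∈ (θ_min, 0) for which q_{θ₂} is a density (i.e., ∫ q_{θ₂} dμ = 1). -/

import Mathlib

open MeasureTheory Filter Set Topology
open scoped ENNReal

noncomputable section

variable {Ω : Type*} [MeasurableSpace Ω]

/-- The positive part of an extended real number, as a member of `ℝ≥0∞`. -/
def ePos (x : EReal) : ℝ≥0∞ := if x = ⊤ then ⊤ else ENNReal.ofReal x.toReal

/-- The (signed) integral of an extended-real-valued function: the integral of its
positive part minus the integral of its negative part. -/
def eInt (μ : Measure Ω) (f : Ω → EReal) : EReal :=
  ((∫⁻ r, ePos (f r) ∂μ : ℝ≥0∞) : EReal) - ((∫⁻ r, ePos (-(f r)) ∂μ : ℝ≥0∞) : EReal)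

/-- `p` is a probability density with respect to `μ`. -/
def IsDensity (μ : Measure Ω) (p : Ω → ℝ) : Prop :=
  Measurable p ∧ (∀ r, 0 ≤ p r) ∧ ∫⁻ r, ENNReal.ofReal (p r) ∂μ = 1

/-- `∫ p dμ` for a nonnegative function `p`. -/
def pInt (μ : Measure Ω) (p : Ω → ℝ) : ℝ≥0∞ := ∫⁻ r, ENNReal.ofReal (p r) ∂μ

/-- The convex integral functional `H(p) = ∫ β(r, p(r)) μ(dr)`. -/
def Hfun (μ : Measure Ω) (β : Ω → ℝ → EReal) (p : Ω → ℝ) : EReal :=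
  eInt μ (fun r => β r (p r))

/-- The expected payoff `∫ X p dμ`, as an extended real number. -/
def xInt (μ : Measure Ω) (X p : Ω → ℝ) : EReal :=
  eInt μ (fun r => ((X r * p r : ℝ) : EReal))

/-- The value function `F(b) = inf { H(p) : p density, ∫ X p dμ = b }`. -/
def Ffun (μ : Measure Ω) (β : Ω → ℝ → EReal) (X : Ω → ℝ) (b : ℝ) : EReal :=
  ⨅ p : {p : Ω → ℝ // IsDensity μ p ∧ xInt μ X p = (b : EReal)}, Hfun μ β p.1

/-- The essential infimum `m` of `X`, as an extended real number. -/
def essInfX (μ : Measure Ω) (X : Ω → ℝ) : EReal := essInf (fun r => (X r : EReal)) μ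

/-- The essential supremum `M` of `X`, as an extended real number. -/
def essSupX (μ : Measure Ω) (X : Ω → ℝ) : EReal := essSup (fun r => (X r : EReal)) μ

/-- `k_max = lim_{b ↓ m} F(b)`; since `F` is nonincreasing on `(m, b₀)`, this limit
equals the supremum of `F` over `(m, b₀)`. -/
def kmax (μ : Measure Ω) (β : Ω → ℝ → EReal) (X : Ω → ℝ) (b₀ : ℝ) : EReal :=
  ⨆ b : {b : ℝ // essInfX μ X < (b : EReal) ∧ b < b₀}, Ffun μ β X b

/-- `V(k) = inf { ∫ X p dμ : p density, H(p) ≤ k }`. -/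
def Vfun (μ : Measure Ω) (β : Ω → ℝ → EReal) (X : Ω → ℝ) (k : ℝ) : EReal :=
  ⨅ p : {p : Ω → ℝ // IsDensity μ p ∧ Hfun μ β p ≤ (k : EReal)}, xInt μ X p.1

/-- `W(λ) = inf { ∫ X p dμ + λ H(p) : p density }`. -/
def Wfun (μ : Measure Ω) (β : Ω → ℝ → EReal) (X : Ω → ℝ) (lam : ℝ) : EReal :=
  ⨅ p : {p : Ω → ℝ // IsDensity μ p}, (xInt μ X p.1 + (lam : EReal) * Hfun μ β p.1)

/-- The convex conjugate `β*(r, τ) = sup_s (sτ − β(r,s))` of `β` in its second variable. -/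
def conjβ (β : Ω → ℝ → EReal) (r : Ω) (τ : ℝ) : EReal :=
  ⨆ s : ℝ, (((s * τ : ℝ) : EReal) - β r s)

/-- `K(θ₁, θ₂) = ∫ β*(r, θ₁ + θ₂ X(r)) μ(dr)`. -/
def Kfun (μ : Measure Ω) (β : Ω → ℝ → EReal) (X : Ω → ℝ) (θ₁ θ₂ : ℝ) : EReal :=
  eInt μ (fun r => conjβ β r (θ₁ + θ₂ * X r))

/-- `dom K = {(θ₁, θ₂) : K(θ₁,θ₂) < +∞}`. -/
def domK (μ : Measure Ω) (β : Ω → ℝ → EReal) (X : Ω → ℝ) : Set (ℝ × ℝ) :=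
  {θ : ℝ × ℝ | Kfun μ β X θ.1 θ.2 < ⊤}

/-- `β'(r, +∞) = lim_{s ↑ ∞} β'(r,s)`; by monotonicity of the derivative of a convex
function this equals the supremum of `β'(r, ·)` over `(0, ∞)`. -/
def derivTop (β' : Ω → ℝ → ℝ) (r : Ω) : EReal := ⨆ s : {s : ℝ // 0 < s}, (β' r s.1 : EReal)

/-- `β'(r, 0) = lim_{s ↓ 0} β'(r,s)`, the infimum of `β'(r, ·)` over `(0, ∞)`. -/
def derivZero (β' : Ω → ℝ → ℝ) (r : Ω) : EReal := ⨅ s : {s : ℝ // 0 < s}, (β' r s.1 : EReal)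

/-- The parameter set `Θ`. -/
def ThetaSet (μ : Measure Ω) (β : Ω → ℝ → EReal) (β' : Ω → ℝ → ℝ) (X : Ω → ℝ) :
    Set (ℝ × ℝ) :=
  {θ ∈ domK μ β X | ∀ᵐ r ∂μ, ((θ.1 + θ.2 * X r : ℝ) : EReal) < derivTop β' r}

/-- The generalised exponential family member `p_{θ₁,θ₂}(r) = (β*)'(r, θ₁ + θ₂ X(r))`,
where `ψ` denotes the derivative `(β*)'` of the conjugate in its second variable. -/
def pFam (ψ : Ω → ℝ → ℝ) (X : Ω → ℝ) (θ₁ θ₂ : ℝ) : Ω → ℝ :=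
  fun r => ψ r (θ₁ + θ₂ * X r)

/-- `G(θ₂) = inf_{θ₁} [K(θ₁,θ₂) − θ₁]`. -/
def Gfun (μ : Measure Ω) (β : Ω → ℝ → EReal) (X : Ω → ℝ) (θ₂ : ℝ) : EReal :=
  ⨅ θ₁ : ℝ, (Kfun μ β X θ₁ θ₂ - (θ₁ : EReal))

/-- `Θ₂ = dom G`, the projection of `dom K` to the `θ₂`-axis. -/
def Theta2 (μ : Measure Ω) (β : Ω → ℝ → EReal) (X : Ω → ℝ) : Set ℝ :=
  {θ₂ : ℝ | Gfun μ β X θ₂ < ⊤}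

/-- The Bregman integrand `Δ_β(r, s, t)`; for `t = 0` it is defined as the limit `t ↓ 0`
(with `β'(r,0) = lim_{t↓0} β'(r,t)`), and if `β(r,0) = +∞` then `Δ_β(r,0,0) = 0` and
`Δ_β(r,s,0) = +∞` for `s > 0`. -/
def bregmanInt (β : Ω → ℝ → EReal) (β' : Ω → ℝ → ℝ) (r : Ω) (s t : ℝ) : EReal :=
  if 0 < t then β r s - β r t - ((β' r t : EReal) * ((s - t : ℝ) : EReal))
  else if β r 0 = ⊤ then (if s = 0 then 0 else ⊤)
  else β r s - β r 0 - derivZero β' r * ((s : ℝ) : EReal)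

/-- The (generalised) Bregman distance `B(p, q)`. -/
def Bdist (μ : Measure Ω) (β : Ω → ℝ → EReal) (β' : Ω → ℝ → ℝ) (p q : Ω → ℝ) : EReal :=
  eInt μ (fun r => bregmanInt β β' r (p r) (q r))

/-- The standing assumptions of the framework: `μ` is σ-finite; `β` is a normal convex
integrand (measurable in `r`; equal to `+∞` for `s < 0`; finite, strictly convex and
differentiable with derivative `β'` on `(0,∞)`; right-continuous at `0`); `p₀` is a
density with finite expected payoff `b₀` satisfying `m < b₀ < M`; `H(p₀) = 0 ≤ H(p)`
for every density `p`; and `k_max > 0`. -/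
structure Standing (μ : Measure Ω) (β : Ω → ℝ → EReal) (β' : Ω → ℝ → ℝ)
    (X : Ω → ℝ) (p₀ : Ω → ℝ) (b₀ : ℝ) : Prop where
  sigma : SigmaFinite μ
  betaMeas : ∀ s : ℝ, Measurable (fun r => β r s)
  Xmeas : Measurable X
  betaNeg : ∀ r : Ω, ∀ s : ℝ, s < 0 → β r s = ⊤
  betaNeBot : ∀ r s, β r s ≠ ⊥
  betaFin : ∀ r : Ω, ∀ s : ℝ, 0 < s → β r s ≠ ⊤
  betaZero : ∀ r, Tendsto (fun s => β r s) (𝓝[>] (0:ℝ)) (𝓝 (β r 0))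
  betaConv : ∀ r, StrictConvexOn ℝ (Ioi (0:ℝ)) (fun s => (β r s).toReal)
  betaDeriv : ∀ r : Ω, ∀ s ∈ Ioi (0:ℝ), HasDerivAt (fun t => (β r t).toReal) (β' r s) s
  dens₀ : IsDensity μ p₀
  payoff₀ : xInt μ X p₀ = (b₀ : EReal)
  mlt : essInfX μ X < (b₀ : EReal)
  ltM : (b₀ : EReal) < essSupX μ X
  H₀ : Hfun μ β p₀ = 0
  Hnonneg : ∀ p, IsDensity μ p → 0 ≤ Hfun μ β p
  kmaxPos : 0 < kmax μ β X b₀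

/-- The hypothesis that `ψ = (β*)'`: at every point `τ < β'(r,+∞)`, where the conjugate
`β*(r,·)` is finite and differentiable, `ψ r τ` is its derivative. -/
def IsConjDeriv (β : Ω → ℝ → EReal) (β' : Ω → ℝ → ℝ) (ψ : Ω → ℝ → ℝ) : Prop :=
  ∀ r : Ω, ∀ τ : ℝ, ((τ : ℝ) : EReal) < derivTop β' r →
    HasDerivAt (fun t => (conjβ β r t).toReal) (ψ r τ) τ

/-- `(θ₁, θ₂)` with `θ₂ < 0` attains the double maximum
`max_{θ₂<0} max_{θ₁} (k + K(θ₁,θ₂) − θ₁)/θ₂` (whose value is `V(k)`); such a pair is a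
parameter pair of the worst case localiser `q̂_k = p_{θ₁,θ₂}`. -/
def IsWCLParam (μ : Measure Ω) (β : Ω → ℝ → EReal) (X : Ω → ℝ) (k : ℝ) (θ₁ θ₂ : ℝ) : Prop :=
  θ₂ < 0 ∧ ∀ θ₁' θ₂' : ℝ, θ₂' < 0 →
    ((k : EReal) + Kfun μ β X θ₁' θ₂' - (θ₁' : EReal)) / ((θ₂' : ℝ) : EReal) ≤
      ((k : EReal) + Kfun μ β X θ₁ θ₂ - (θ₁ : EReal)) / ((θ₂ : ℝ) : EReal)

/-- `p` is an (ε-γ)-almost worst case density for threshold `k`. -/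
def AWCD (μ : Measure Ω) (β : Ω → ℝ → EReal) (X : Ω → ℝ) (k ε γ : ℝ) (p : Ω → ℝ) : Prop :=
  IsDensity μ p ∧ Hfun μ β p ≤ ((k + γ : ℝ) : EReal) ∧
    xInt μ X p ≤ Vfun μ β X k + (ε : EReal)

/-- Convergence locally in measure. -/
def TendstoLocallyInMeasure (μ : Measure Ω) (p : ℕ → Ω → ℝ) (q : Ω → ℝ) : Prop :=
  ∀ C : Set Ω, MeasurableSet C → μ C < ⊤ → ∀ ε : ℝ, 0 < ε →
    Tendsto (fun n => μ {r ∈ C | ε < |p n r - q r|}) atTop (𝓝 0)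

end

theorem tendsto_slope_ray_of_le {g : ℝ → ℝ} {θ x v : ℝ} (hv : v ≠ 0) {m : ℝ → ℝ}
    (hlow : ∀ ε ∈ Ioc (0 : ℝ) 1, g θ + x * (ε * v) ≤ g (θ + ε * v))
    (hup : ∀ ε ∈ Ioc (0 : ℝ) 1, g (θ + ε * v) ≤ g θ + m ε)
    (hm : Tendsto (fun ε => m ε / ε) (𝓝[>] 0) (𝓝 (x * v))) :
    Tendsto (fun ε => slope g θ (θ + ε * v)) (𝓝[>] 0) (𝓝 x) := by
  have hlim : Tendsto (fun ε => (g (θ + ε * v) - g θ) / ε) (𝓝[>] 0) (𝓝 (x * v)) := by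
    refine tendsto_of_tendsto_of_tendsto_of_le_of_le' tendsto_const_nhds hm ?_ ?_
    · filter_upwards [Ioc_mem_nhdsGT (zero_lt_one' ℝ)] with ε hε
      rw [le_div_iff₀ hε.1]
      linarith [hlow ε hε]
    · filter_upwards [Ioc_mem_nhdsGT (zero_lt_one' ℝ)] with ε hε
      exact div_le_div_of_nonneg_right (by linarith [hup ε hε]) hε.1.le
  have h := hlim.div_const v
  rw [mul_div_cancel_right₀ _ hv] at h
  refine h.congr fun ε => ?_
  rw [slope_def_field, add_sub_cancel_left, div_div]

theorem hasDerivAt_of_tendsto_slope_rays {g : ℝ → ℝ} {θ x v w : ℝ} (hv : 0 < v) (hw : w < 0)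
    (hright : Tendsto (fun ε => slope g θ (θ + ε * v)) (𝓝[>] 0) (𝓝 x))
    (hleft : Tendsto (fun ε => slope g θ (θ + ε * w)) (𝓝[>] 0) (𝓝 x)) : HasDerivAt g x θ := by
  have hcont : ∀ k : ℝ, Tendsto (fun t => (t - θ) / k) (𝓝 θ) (𝓝 0) := fun k => by
    have h := (by fun_prop : Continuous fun t : ℝ => (t - θ) / k).tendsto θ
    simpa using h
  rw [hasDerivAt_iff_tendsto_slope_left_right]
  constructor
  · have h : Tendsto (fun t => (t - θ) / w) (𝓝[<] θ) (𝓝[>] 0) :=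
      tendsto_nhdsWithin_iff.2 ⟨(hcont w).mono_left nhdsWithin_le_nhds, by
        filter_upwards [self_mem_nhdsWithin] with t ht
        exact div_pos_of_neg_of_neg (sub_neg.2 ht) hw⟩
    refine (hleft.comp h).congr fun t => ?_
    simp [div_mul_cancel₀ _ hw.ne]
  · have h : Tendsto (fun t => (t - θ) / v) (𝓝[>] θ) (𝓝[>] 0) :=
      tendsto_nhdsWithin_iff.2 ⟨(hcont v).mono_left nhdsWithin_le_nhds, by
        filter_upwards [self_mem_nhdsWithin] with t ht
        exact div_pos (sub_pos.2 ht) hv⟩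
    refine (hright.comp h).congr fun t => ?_
    simp [div_mul_cancel₀ _ hv.ne']

theorem ePos_coe (x : ℝ) : ePos (x : EReal) = ENNReal.ofReal x := by
  simp [ePos]

theorem ePos_mono : Monotone ePos := by
  intro x y hxy
  induction y using EReal.rec with
  | top => simp [ePos]
  | bot => simp_all
  | coe y =>
    induction x using EReal.rec with
    | top => simp at hxy
    | bot => simp [ePos]
    | coe x =>
      rw [ePos_coe, ePos_coe]
      exact ENNReal.ofReal_le_ofReal (EReal.coe_le_coe_iff.1 hxy)

theorem enorm_toReal_le_ePos_add (y : EReal) : ‖y.toReal‖ₑ ≤ ePos y + ePos (-y) := by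
  induction y using EReal.rec with
  | top => simp
  | bot => simp
  | coe x =>
    rw [← EReal.coe_neg, ePos_coe, ePos_coe, EReal.toReal_coe, Real.enorm_eq_ofReal_abs]
    rcases abs_cases x with ⟨h, _⟩ | ⟨h, _⟩ <;> rw [h] <;> simp

theorem measurable_ePos : Measurable ePos := ePos_mono.measurable

section ExtendedIntegral

variable {Ω : Type*} [MeasurableSpace Ω] {μ : Measure Ω}

theorem eInt_mono_ae {f g : Ω → EReal} (h : ∀ᵐ r ∂μ, f r ≤ g r) : eInt μ f ≤ eInt μ g := by
  refine EReal.sub_le_sub ?_ ?_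
  · exact_mod_cast lintegral_mono_ae (h.mono fun r hr => ePos_mono hr)
  · exact_mod_cast lintegral_mono_ae (h.mono fun r hr => ePos_mono (EReal.neg_le_neg_iff.2 hr))

theorem eInt_congr_ae {f g : Ω → EReal} (h : ∀ᵐ r ∂μ, f r = g r) : eInt μ f = eInt μ g :=
  le_antisymm (eInt_mono_ae (h.mono fun _ hr => hr.le)) (eInt_mono_ae (h.mono fun _ hr => hr.ge))

theorem eInt_coe {g : Ω → ℝ} (hg : Integrable g μ) :
    eInt μ (fun r => (g r : EReal)) = ((∫ r, g r ∂μ : ℝ) : EReal) := by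
  have h1 : (∫⁻ r, ENNReal.ofReal (g r) ∂μ) ≠ ⊤ := hg.lintegral_lt_top.ne
  have h2 : (∫⁻ r, ENNReal.ofReal (-g r) ∂μ) ≠ ⊤ := hg.neg.lintegral_lt_top.ne
  rw [eInt, integral_eq_lintegral_pos_part_sub_lintegral_neg_part hg]
  simp only [← EReal.coe_neg, ePos_coe]
  rw [EReal.coe_sub, EReal.coe_ennreal_toReal h1, EReal.coe_ennreal_toReal h2]

theorem integrable_toReal_of_lintegral_ePos {f : Ω → EReal} (hf : Measurable f)
    (hpos : ∫⁻ r, ePos (f r) ∂μ ≠ ⊤) (hneg : ∫⁻ r, ePos (-(f r)) ∂μ ≠ ⊤) :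
    (∀ᵐ r ∂μ, f r ≠ ⊤) ∧ Integrable (fun r => (f r).toReal) μ := by
  constructor
  · filter_upwards [ae_lt_top (measurable_ePos.comp hf) hpos] with r hr htop
    simp [ePos, htop] at hr
  · refine ⟨hf.ereal_toReal.aestronglyMeasurable, ?_⟩
    have hsum : ∫⁻ r, ePos (f r) + ePos (-(f r)) ∂μ < ⊤ := by
      rw [lintegral_add_left (f := fun r => ePos (f r)) (measurable_ePos.comp hf)]
      exact ENNReal.add_lt_top.2 ⟨hpos.lt_top, hneg.lt_top⟩
    exact lt_of_le_of_lt (lintegral_mono fun r => enorm_toReal_le_ePos_add _) hsum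

theorem integrable_toReal_of_eInt_lt_top {f : Ω → EReal} (hf : Measurable f) {L : Ω → ℝ}
    (hL : Integrable L μ) (hLf : ∀ᵐ r ∂μ, (L r : EReal) ≤ f r) (hlt : eInt μ f < ⊤) :
    (∀ᵐ r ∂μ, f r ≠ ⊤) ∧ Integrable (fun r => (f r).toReal) μ := by
  have hneg : ∫⁻ r, ePos (-(f r)) ∂μ ≠ ⊤ := by
    refine (lt_of_le_of_lt (lintegral_mono_ae ?_) hL.neg.lintegral_lt_top).ne
    filter_upwards [hLf] with r hr
    rw [← ePos_coe]
    exact ePos_mono (by simpa using EReal.neg_le_neg_iff.2 hr)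
  refine integrable_toReal_of_lintegral_ePos hf (fun hpos => ?_) hneg
  rw [eInt, hpos, ← EReal.coe_ennreal_toReal hneg] at hlt
  simp at hlt

theorem integrable_toReal_of_eInt_eq_coe {f : Ω → EReal} (hf : Measurable f) {a : ℝ}
    (h : eInt μ f = a) : (∀ᵐ r ∂μ, f r ≠ ⊤) ∧ Integrable (fun r => (f r).toReal) μ := by
  have hneg : ∫⁻ r, ePos (-(f r)) ∂μ ≠ ⊤ := by
    intro hneg
    rw [eInt, hneg] at h
    simp at h
  refine integrable_toReal_of_lintegral_ePos hf (fun hpos => ?_) hneg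
  rw [eInt, hpos, ← EReal.coe_ennreal_toReal hneg] at h
  simp at h

end ExtendedIntegral

theorem tendsto_conjβ_quotient {Ω : Type*} {β : Ω → ℝ → EReal} {r : Ω} {τ q : ℝ}
    (hq : HasDerivAt (fun t => (conjβ β r t).toReal) q τ) (w : ℝ) :
    Tendsto (fun ε : ℝ => ((conjβ β r (τ + ε * w)).toReal - (conjβ β r τ).toReal) / ε)
      (𝓝[>] 0) (𝓝 (w * q)) := by
  have hline : HasDerivAt (fun ε : ℝ => τ + ε * w) w 0 := by
    simpa using ((hasDerivAt_id (0 : ℝ)).mul_const w).const_add τ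
  have hcomp : HasDerivAt (fun ε : ℝ => (conjβ β r (τ + ε * w)).toReal) (q * w) 0 :=
    HasDerivAt.comp (h₂ := fun t => (conjβ β r t).toReal) 0 (by simpa using hq) hline
  have := hcomp.tendsto_slope_zero_right
  rw [mul_comm w q]
  refine this.congr fun ε => ?_
  simp [div_eq_inv_mul]

section Conjugate

variable {Ω : Type*} [MeasurableSpace Ω] {μ : Measure Ω} {β : Ω → ℝ → EReal} {β' : Ω → ℝ → ℝ}
  {X : Ω → ℝ} {p₀ : Ω → ℝ} {b₀ : ℝ}

theorem le_conjβ (hst : Standing μ β β' X p₀ b₀) {r : Ω} {s : ℝ} (hs : β r s ≠ ⊤) (τ : ℝ) :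
    ((s * τ - (β r s).toReal : ℝ) : EReal) ≤ conjβ β r τ := by
  rw [EReal.coe_sub, EReal.coe_toReal hs (hst.betaNeBot r s)]
  exact le_iSup (fun s : ℝ => ((s * τ : ℝ) : EReal) - β r s) s

theorem conjβ_ne_bot (hst : Standing μ β β' X p₀ b₀) (r : Ω) (τ : ℝ) : conjβ β r τ ≠ ⊥ := by
  intro h
  have := le_conjβ hst (hst.betaFin r 1 one_pos) τ
  rw [h, le_bot_iff] at this
  exact EReal.coe_ne_bot _ this

theorem conjβ_le (hst : Standing μ β β' X p₀ b₀) {r : Ω} {τ : ℝ} {C : EReal}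
    (h : ∀ s : ℝ, 0 < s → ((s * τ - (β r s).toReal : ℝ) : EReal) ≤ C) : conjβ β r τ ≤ C := by
  refine iSup_le fun s => ?_
  rcases lt_trichotomy s 0 with hs | rfl | hs
  · simp [hst.betaNeg r s hs]
  · induction C using EReal.rec with
    | top => exact le_top
    | bot => exact absurd (le_bot_iff.1 (h 1 one_pos)) (EReal.coe_ne_bot _)
    | coe C =>
      have hlim : ((0 * τ - C : ℝ) : EReal) ≤ β r 0 := by
        refine le_of_tendsto_of_tendsto (b := 𝓝[>] (0 : ℝ))
          (f := fun s : ℝ => ((s * τ - C : ℝ) : EReal)) ?_ (hst.betaZero r) ?_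
        · refine (continuous_coe_real_ereal.comp (by fun_prop : Continuous
            fun s : ℝ => s * τ - C)).continuousAt.tendsto.mono_left nhdsWithin_le_nhds
        · filter_upwards [self_mem_nhdsWithin] with s hs
          rw [← EReal.coe_toReal (hst.betaFin r s hs) (hst.betaNeBot r s)]
          have := EReal.coe_le_coe_iff.1 (h s hs)
          exact EReal.coe_le_coe_iff.2 (by linarith)
      have hbot := hst.betaNeBot r 0
      generalize β r 0 = y at hlim hbot
      induction y using EReal.rec with
      | top => simp
      | bot => exact absurd rfl hbot
      | coe y =>
        have := EReal.coe_le_coe_iff.1 hlim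
        rw [← EReal.coe_sub]
        exact EReal.coe_le_coe_iff.2 (by linarith)
  · rw [← EReal.coe_toReal (hst.betaFin r s hs) (hst.betaNeBot r s), ← EReal.coe_sub]
    exact h s hs

theorem coe_toReal_conjβ (hst : Standing μ β β' X p₀ b₀) {r : Ω} {τ : ℝ} (h : conjβ β r τ ≠ ⊤) :
    ((conjβ β r τ).toReal : EReal) = conjβ β r τ :=
  EReal.coe_toReal h (conjβ_ne_bot hst r τ)

theorem le_toReal_conjβ (hst : Standing μ β β' X p₀ b₀) {r : Ω} {s τ : ℝ} (hs : β r s ≠ ⊤)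
    (h : conjβ β r τ ≠ ⊤) : s * τ - (β r s).toReal ≤ (conjβ β r τ).toReal := by
  rw [← EReal.coe_le_coe_iff, coe_toReal_conjβ hst h]
  exact le_conjβ hst hs τ

theorem conjβ_mono (hst : Standing μ β β' X p₀ b₀) (r : Ω) : Monotone (conjβ β r) := by
  intro τ τ' hτ
  refine conjβ_le hst fun s hs => le_trans ?_ (le_conjβ hst (hst.betaFin r s hs) τ')
  exact EReal.coe_le_coe_iff.2 (by nlinarith)

theorem conjβ_combo_le (hst : Standing μ β β' X p₀ b₀) {r : Ω} {τ τ' a b : ℝ}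
    (h : conjβ β r τ ≠ ⊤) (h' : conjβ β r τ' ≠ ⊤) (ha : 0 ≤ a) (hb : 0 ≤ b) (hab : a + b = 1) :
    conjβ β r (a * τ + b * τ') ≤
      ((a * (conjβ β r τ).toReal + b * (conjβ β r τ').toReal : ℝ) : EReal) := by
  refine conjβ_le hst fun s hs => EReal.coe_le_coe_iff.2 ?_
  have h1 := mul_le_mul_of_nonneg_left (le_toReal_conjβ hst (hst.betaFin r s hs) h) ha
  have h2 := mul_le_mul_of_nonneg_left (le_toReal_conjβ hst (hst.betaFin r s hs) h') hb
  have : (β r s).toReal = a * (β r s).toReal + b * (β r s).toReal := by rw [← add_mul, hab, one_mul]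
  nlinarith

theorem tendsto_toReal_beta (hst : Standing μ β β' X p₀ b₀) {r : Ω} {s : ℝ} (hs : 0 ≤ s)
    (hfin : β r s ≠ ⊤) :
    Tendsto (fun t => (β r t).toReal) (𝓝[>] s) (𝓝 (β r s).toReal) := by
  rcases hs.eq_or_lt with rfl | hs
  · exact (EReal.tendsto_toReal hfin (hst.betaNeBot r 0)).comp (hst.betaZero r)
  · exact (hst.betaDeriv r s hs).continuousAt.tendsto.mono_left nhdsWithin_le_nhds

theorem tendsto_beta (hst : Standing μ β β' X p₀ b₀) {r : Ω} {s : ℝ} (hs : 0 ≤ s) :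
    Tendsto (β r) (𝓝[>] s) (𝓝 (β r s)) := by
  rcases hs.eq_or_lt with rfl | hs
  · exact hst.betaZero r
  · have h := tendsto_toReal_beta hst hs.le (hst.betaFin r s hs)
    have h' := (continuous_coe_real_ereal.tendsto _).comp h
    rw [EReal.coe_toReal (hst.betaFin r s hs) (hst.betaNeBot r s)] at h'
    refine h'.congr' ?_
    filter_upwards [self_mem_nhdsWithin] with t ht
    exact EReal.coe_toReal (hst.betaFin r t (hs.trans ht)) (hst.betaNeBot r t)

theorem measurable_beta_comp (hst : Standing μ β β' X p₀ b₀) {p : Ω → ℝ} (hp : Measurable p)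
    (hp0 : ∀ r, 0 ≤ p r) : Measurable (fun r => β r (p r)) := by
  let k : ℕ → Ω → ℕ := fun n r => ⌊((n : ℝ) + 1) * p r⌋₊
  have hk : ∀ n, Measurable (k n) := fun n => Nat.measurable_floor.comp (hp.const_mul _)
  have hlim : ∀ r, Tendsto (fun n : ℕ => ((k n r : ℝ) + 1) / ((n : ℝ) + 1)) atTop (𝓝[>] (p r)) := by
    intro r
    have hbd : ∀ n : ℕ, p r < ((k n r : ℝ) + 1) / ((n : ℝ) + 1) ∧
        ((k n r : ℝ) + 1) / ((n : ℝ) + 1) ≤ p r + 1 / ((n : ℝ) + 1) := by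
      intro n
      have hn : (0 : ℝ) < (n : ℝ) + 1 := by positivity
      constructor
      · rw [lt_div_iff₀ hn, mul_comm]
        exact Nat.lt_floor_add_one _
      · rw [add_div]
        gcongr
        rw [div_le_iff₀ hn, mul_comm]
        exact Nat.floor_le (mul_nonneg hn.le (hp0 r))
    refine tendsto_nhdsWithin_iff.2 ⟨?_, Eventually.of_forall fun n => (hbd n).1⟩
    refine tendsto_of_tendsto_of_tendsto_of_le_of_le tendsto_const_nhds ?_
      (fun n => (hbd n).1.le) (fun n => (hbd n).2)
    simpa using tendsto_const_nhds.add (tendsto_one_div_add_atTop_nhds_zero_nat (𝕜 := ℝ))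
  have hmeas : ∀ n, Measurable (fun r => β r (((k n r : ℝ) + 1) / ((n : ℝ) + 1))) := by
    intro n
    have h2 : Measurable (fun z : Ω × ℕ => β z.1 (((z.2 : ℝ) + 1) / ((n : ℝ) + 1))) :=
      measurable_from_prod_countable_left fun j => hst.betaMeas (((j : ℝ) + 1) / ((n : ℝ) + 1))
    exact h2.comp (measurable_id.prodMk (hk n))
  refine measurable_of_tendsto_metrizable hmeas (tendsto_pi_nhds.2 fun r => ?_)
  exact (tendsto_beta hst (hp0 r)).comp (hlim r)

theorem measurable_conjβ_comp (hst : Standing μ β β' X p₀ b₀) {T : Ω → ℝ} (hT : Measurable T) :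
    Measurable (fun r => conjβ β r (T r)) := by
  have heq : (fun r => conjβ β r (T r)) = fun r => ⨆ q : {q : ℚ // 0 < q},
      (((q.1 : ℝ) * T r - (β r (q.1 : ℝ)).toReal : ℝ) : EReal) := by
    funext r
    have hcast : ∀ q : {q : ℚ // 0 < q}, (0 : ℝ) < (q.1 : ℝ) := fun q => by exact_mod_cast q.2
    refine le_antisymm (conjβ_le hst fun s hs => ?_)
      (iSup_le fun q => le_conjβ hst (hst.betaFin r _ (hcast q)) _)
    by_contra! hlt
    have hcont : Tendsto (fun t : ℝ => ((t * T r - (β r t).toReal : ℝ) : EReal)) (𝓝[>] s)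
        (𝓝 ((s * T r - (β r s).toReal : ℝ) : EReal)) := by
      refine (continuous_coe_real_ereal.tendsto _).comp (Tendsto.sub ?_
        (tendsto_toReal_beta hst hs.le (hst.betaFin r s hs)))
      exact (by fun_prop : Continuous fun t : ℝ => t * T r).continuousAt.tendsto.mono_left
        nhdsWithin_le_nhds
    obtain ⟨u, hu, hsub⟩ := mem_nhdsGT_iff_exists_Ioo_subset.1
      (hcont.eventually (lt_mem_nhds hlt))
    obtain ⟨q, hq1, hq2⟩ := exists_rat_btwn (show s < u from hu)
    have hq0 : 0 < q := by exact_mod_cast hs.trans hq1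
    have hmem : (q : ℝ) ∈ Ioo s u := ⟨hq1, hq2⟩
    exact absurd (hsub hmem) (not_lt.2 (le_iSup (fun q : {q : ℚ // 0 < q} =>
      (((q.1 : ℝ) * T r - (β r (q.1 : ℝ)).toReal : ℝ) : EReal)) ⟨q, hq0⟩))
  rw [heq]
  refine Measurable.iSup fun q => measurable_coe_real_ereal.comp ?_
  exact (hT.const_mul _).sub (hst.betaMeas _).ereal_toReal

theorem conjβ_segment_ne_top (hst : Standing μ β β' X p₀ b₀) {r : Ω} {τ w : ℝ}
    (h : conjβ β r τ ≠ ⊤) (h' : conjβ β r (τ + w) ≠ ⊤) {ε : ℝ} (h0 : 0 ≤ ε) (h1 : ε ≤ 1) :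
    conjβ β r (τ + ε * w) ≠ ⊤ ∧ (conjβ β r (τ + ε * w)).toReal ≤
      (conjβ β r τ).toReal + ε * ((conjβ β r (τ + w)).toReal - (conjβ β r τ).toReal) := by
  have hle := conjβ_combo_le hst h h' (sub_nonneg.2 h1) h0 (by ring)
  rw [show (1 - ε) * τ + ε * (τ + w) = τ + ε * w by ring] at hle
  have hne : conjβ β r (τ + ε * w) ≠ ⊤ := (lt_of_le_of_lt hle (EReal.coe_lt_top _)).ne
  refine ⟨hne, ?_⟩
  rw [← coe_toReal_conjβ hst hne, EReal.coe_le_coe_iff] at hle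
  linarith

theorem mul_le_conjβ_quotient (hst : Standing μ β β' X p₀ b₀) {r : Ω} {τ w q : ℝ}
    (h : conjβ β r τ ≠ ⊤) (h' : conjβ β r (τ + w) ≠ ⊤)
    (hq : HasDerivAt (fun t => (conjβ β r t).toReal) q τ) :
    w * q ≤ (conjβ β r (τ + w)).toReal - (conjβ β r τ).toReal := by
  refine le_of_tendsto (tendsto_conjβ_quotient hq w) ?_
  filter_upwards [Ioc_mem_nhdsGT (zero_lt_one' ℝ)] with ε hε
  rw [div_le_iff₀ hε.1]
  linarith [(conjβ_segment_ne_top hst h h' hε.1.le hε.2).2]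

theorem toReal_conjβ_mono (hst : Standing μ β β' X p₀ b₀) {r : Ω} {τ τ' : ℝ} (hτ : τ ≤ τ')
    (h : conjβ β r τ' ≠ ⊤) : (conjβ β r τ).toReal ≤ (conjβ β r τ').toReal :=
  EReal.toReal_le_toReal (conjβ_mono hst r hτ) (conjβ_ne_bot hst r τ) h

theorem conjβ_ne_top_of_le (hst : Standing μ β β' X p₀ b₀) {r : Ω} {τ τ' : ℝ} (hτ : τ ≤ τ')
    (h : conjβ β r τ' ≠ ⊤) : conjβ β r τ ≠ ⊤ :=
  (lt_of_le_of_lt (conjβ_mono hst r hτ) h.lt_top).ne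

theorem conjβ_deriv_nonneg (hst : Standing μ β β' X p₀ b₀) {r : Ω} {τ q : ℝ}
    (h : conjβ β r τ ≠ ⊤) (hq : HasDerivAt (fun t => (conjβ β r t).toReal) q τ) : 0 ≤ q := by
  have hle : τ + -1 ≤ τ := by linarith
  have h1 := mul_le_conjβ_quotient hst h (conjβ_ne_top_of_le hst hle h) hq
  linarith [toReal_conjβ_mono hst hle h]

theorem tendsto_conjβ_quotient_atTop (hst : Standing μ β β' X p₀ b₀) {r : Ω} {τ : ℝ}
    (h : conjβ β r τ ≠ ⊤) (hτ : ¬ (τ : EReal) < derivTop β' r) :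
    Tendsto (fun n : ℕ => ((n : ℝ) + 1) *
      ((conjβ β r τ).toReal - (conjβ β r (τ - 1 / ((n : ℝ) + 1))).toReal)) atTop atTop := by
  have hslope : ∀ N : ℝ, 0 < N → (β r (N + 1)).toReal - (β r N).toReal < τ := by
    intro N hN
    have hN1 : (0 : ℝ) < N + 1 := by linarith
    have h1 := (hst.betaConv r).slope_lt_of_hasDerivAt hN hN1 (by linarith)
      (hst.betaDeriv r (N + 1) hN1)
    rw [slope_def_field, add_sub_cancel_left, div_one] at h1
    refine h1.trans_le (EReal.coe_le_coe_iff.1 (le_trans ?_ (not_lt.1 hτ)))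
    exact le_iSup (fun s : {s : ℝ // 0 < s} => (β' r s.1 : EReal)) ⟨N + 1, hN1⟩
  refine tendsto_atTop.2 fun C => ?_
  set N : ℝ := max C 1 with hNdef
  have hN : 0 < N := lt_of_lt_of_le one_pos (le_max_right _ _)
  have hsmall : ∀ᶠ n : ℕ in atTop, 1 / ((n : ℝ) + 1) <
      τ - ((β r (N + 1)).toReal - (β r N).toReal) :=
    tendsto_one_div_add_atTop_nhds_zero_nat.eventually (gt_mem_nhds (sub_pos.2 (hslope N hN)))
  filter_upwards [hsmall] with n hn
  set ε : ℝ := 1 / ((n : ℝ) + 1) with hε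
  have hn0 : (0 : ℝ) < (n : ℝ) + 1 := by positivity
  have hε0 : 0 < ε := by positivity
  have hle : conjβ β r (τ - ε) ≤ (((conjβ β r τ).toReal - N * ε : ℝ) : EReal) := by
    refine conjβ_le hst fun s hs => EReal.coe_le_coe_iff.2 ?_
    rcases le_or_gt N s with hNs | hsN
    · have := le_toReal_conjβ hst (hst.betaFin r s hs) h
      nlinarith
    · have h1 := le_toReal_conjβ hst (hst.betaFin r N hN) h
      have h2 := (hst.betaConv r).convexOn.slope_mono_adjacent hs
        (show (0 : ℝ) < N + 1 by linarith) hsN (lt_add_one N)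
      rw [add_sub_cancel_left, div_one, div_le_iff₀ (sub_pos.2 hsN)] at h2
      nlinarith
  rw [← coe_toReal_conjβ hst (conjβ_ne_top_of_le hst (by linarith) h), EReal.coe_le_coe_iff] at hle
  have hmul : ((n : ℝ) + 1) * ε = 1 := by rw [hε]; field_simp
  calc C ≤ N := le_max_left _ _
    _ = ((n : ℝ) + 1) * (N * ε) := by rw [mul_left_comm, hmul, mul_one]
    _ ≤ _ := by gcongr; linarith

theorem ae_lt_derivTop_of_integral_le (hst : Standing μ β β' X p₀ b₀) {T : Ω → ℝ}
    (hT : Measurable T) (hfin : ∀ᵐ r ∂μ, conjβ β r (T r) ≠ ⊤)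
    (hint : Integrable (fun r => (conjβ β r (T r)).toReal) μ)
    (hint' : ∀ ε : ℝ, 0 < ε → Integrable (fun r => (conjβ β r (T r - ε)).toReal) μ)
    (hmin : ∀ ε : ℝ, 0 < ε → ∫ r, (conjβ β r (T r)).toReal ∂μ ≤
      ∫ r, (conjβ β r (T r - ε)).toReal ∂μ + ε) :
    ∀ᵐ r ∂μ, (T r : EReal) < derivTop β' r := by
  let D : ℕ → Ω → ℝ := fun n r => ((n : ℝ) + 1) *
    ((conjβ β r (T r)).toReal - (conjβ β r (T r - 1 / ((n : ℝ) + 1))).toReal)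
  have hDm : ∀ n, Measurable (fun r => ENNReal.ofReal (D n r)) := fun n =>
    (((measurable_conjβ_comp hst hT).ereal_toReal.sub
      (measurable_conjβ_comp hst (hT.sub_const _)).ereal_toReal).const_mul _).ennreal_ofReal
  have hD1 : ∀ n, ∫⁻ r, ENNReal.ofReal (D n r) ∂μ ≤ 1 := by
    intro n
    have hn0 : (0 : ℝ) < (n : ℝ) + 1 := by positivity
    have hε0 : (0 : ℝ) < 1 / ((n : ℝ) + 1) := by positivity
    have hDint : Integrable (D n) μ := (hint.sub (hint' _ hε0)).const_mul _
    rw [← ofReal_integral_eq_lintegral_ofReal hDint, ENNReal.ofReal_le_one]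
    · have h1 := hmin _ hε0
      have h2 : ∫ r, D n r ∂μ = ((n : ℝ) + 1) * (∫ r, (conjβ β r (T r)).toReal ∂μ -
          ∫ r, (conjβ β r (T r - 1 / ((n : ℝ) + 1))).toReal ∂μ) := by
        rw [← integral_sub hint (hint' _ hε0), ← integral_const_mul]
      rw [h2, ← le_div_iff₀' hn0]
      linarith
    · filter_upwards [hfin] with r hr
      exact mul_nonneg hn0.le (sub_nonneg.2 (toReal_conjβ_mono hst (by linarith) hr))
  have hlim : ∫⁻ r, liminf (fun n => ENNReal.ofReal (D n r)) atTop ∂μ ≠ ⊤ := by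
    refine ne_top_of_le_ne_top ENNReal.one_ne_top ((lintegral_liminf_le hDm).trans ?_)
    calc liminf (fun n => ∫⁻ r, ENNReal.ofReal (D n r) ∂μ) atTop
        ≤ liminf (fun _ : ℕ => (1 : ℝ≥0∞)) atTop := liminf_le_liminf (Eventually.of_forall hD1)
      _ = 1 := liminf_const 1
  filter_upwards [ae_lt_top (Measurable.liminf hDm) hlim, hfin] with r hr hr'
  by_contra hcon
  have := ENNReal.tendsto_ofReal_nhds_top.2 (tendsto_conjβ_quotient_atTop hst hr' hcon)
  exact hr.ne this.liminf_eq

theorem tendsto_integral_conjβ_quotient (hst : Standing μ β β' X p₀ b₀) {T w q : Ω → ℝ}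
    (hfin : ∀ᵐ r ∂μ, conjβ β r (T r) ≠ ⊤) (hfin' : ∀ᵐ r ∂μ, conjβ β r (T r + w r) ≠ ⊤)
    (hint : ∀ ε : ℝ, 0 ≤ ε → ε ≤ 1 →
      Integrable (fun r => (conjβ β r (T r + ε * w r)).toReal) μ)
    (hq : ∀ᵐ r ∂μ, HasDerivAt (fun t => (conjβ β r t).toReal) (q r) (T r))
    (hwq : Integrable (fun r => w r * q r) μ) :
    Tendsto (fun ε : ℝ => (∫ r, (conjβ β r (T r + ε * w r)).toReal ∂μ -
      ∫ r, (conjβ β r (T r)).toReal ∂μ) / ε) (𝓝[>] 0) (𝓝 (∫ r, w r * q r ∂μ)) := by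
  have hint0 : Integrable (fun r => (conjβ β r (T r)).toReal) μ := by
    simpa using hint 0 le_rfl zero_le_one
  have hint1 : Integrable (fun r => (conjβ β r (T r + w r)).toReal) μ := by
    simpa using hint 1 zero_le_one le_rfl
  have hunit : ∀ᶠ ε : ℝ in 𝓝[>] 0, ε ∈ Ioc (0 : ℝ) 1 := Ioc_mem_nhdsGT (zero_lt_one' ℝ)
  have hlim : Tendsto (fun ε : ℝ => ∫ r, ((conjβ β r (T r + ε * w r)).toReal -
      (conjβ β r (T r)).toReal) / ε ∂μ) (𝓝[>] 0) (𝓝 (∫ r, w r * q r ∂μ)) := by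
    refine tendsto_integral_filter_of_dominated_convergence
      (fun r => |w r * q r| + |(conjβ β r (T r + w r)).toReal - (conjβ β r (T r)).toReal|)
      ?_ ?_ (hwq.abs.add (hint1.sub hint0).abs) ?_
    · filter_upwards [hunit] with ε hε
      exact (((hint ε hε.1.le hε.2).sub hint0).div_const ε).aestronglyMeasurable
    · filter_upwards [hunit] with ε hε
      filter_upwards [hfin, hfin', hq] with r hr hr' hqr
      have hseg := conjβ_segment_ne_top hst hr hr' hε.1.le hε.2
      have hup : ((conjβ β r (T r + ε * w r)).toReal - (conjβ β r (T r)).toReal) / ε ≤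
          (conjβ β r (T r + w r)).toReal - (conjβ β r (T r)).toReal := by
        rw [div_le_iff₀ hε.1]
        linarith [hseg.2]
      have hlow : w r * q r ≤
          ((conjβ β r (T r + ε * w r)).toReal - (conjβ β r (T r)).toReal) / ε := by
        rw [le_div_iff₀ hε.1]
        linarith [mul_le_conjβ_quotient hst hr hseg.1 hqr]
      rw [Real.norm_eq_abs]
      refine abs_le.2 ⟨?_, ?_⟩
      · linarith [neg_abs_le (w r * q r),
          abs_nonneg ((conjβ β r (T r + w r)).toReal - (conjβ β r (T r)).toReal)]
      · linarith [abs_nonneg (w r * q r),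
          le_abs_self ((conjβ β r (T r + w r)).toReal - (conjβ β r (T r)).toReal)]
    · filter_upwards [hq] with r hqr using tendsto_conjβ_quotient hqr (w r)
  refine hlim.congr' ?_
  filter_upwards [hunit] with ε hε
  rw [integral_div, integral_sub (hint ε hε.1.le hε.2) hint0]

theorem beta_density_integrable (hst : Standing μ β β' X p₀ b₀) :
    (∀ᵐ r ∂μ, β r (p₀ r) ≠ ⊤) ∧ Integrable (fun r => (β r (p₀ r)).toReal) μ :=
  integrable_toReal_of_eInt_eq_coe (measurable_beta_comp hst hst.dens₀.1 hst.dens₀.2.1)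
    (a := 0) hst.H₀

theorem integral_beta_density (hst : Standing μ β β' X p₀ b₀) :
    ∫ r, (β r (p₀ r)).toReal ∂μ = 0 := by
  obtain ⟨hfin, hint⟩ := beta_density_integrable hst
  have h := eInt_coe hint
  rw [eInt_congr_ae (g := fun r => β r (p₀ r))
    (hfin.mono fun r hr => EReal.coe_toReal hr (hst.betaNeBot r _))] at h
  exact (EReal.coe_eq_zero.1 (h.symm.trans hst.H₀))

theorem IsDensity.integrable {p : Ω → ℝ} (hp : IsDensity μ p) : Integrable p μ := by
  refine ⟨hp.1.aestronglyMeasurable, ?_⟩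
  rw [hasFiniteIntegral_iff_ofReal (Eventually.of_forall hp.2.1), hp.2.2]
  exact ENNReal.one_lt_top

theorem IsDensity.integral_eq_one {p : Ω → ℝ} (hp : IsDensity μ p) : ∫ r, p r ∂μ = 1 := by
  rw [integral_eq_lintegral_of_nonneg_ae (Eventually.of_forall hp.2.1)
    hp.1.aestronglyMeasurable, hp.2.2, ENNReal.toReal_one]

theorem integrable_payoff_density (hst : Standing μ β β' X p₀ b₀) :
    Integrable (fun r => X r * p₀ r) μ := by
  exact (integrable_toReal_of_eInt_eq_coe
    (measurable_coe_real_ereal.comp (hst.Xmeas.mul hst.dens₀.1)) hst.payoff₀).2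

theorem conjβ_integrable_of_Kfun_lt_top (hst : Standing μ β β' X p₀ b₀) {θ₁ θ₂ : ℝ}
    (hK : Kfun μ β X θ₁ θ₂ < ⊤) :
    (∀ᵐ r ∂μ, conjβ β r (θ₁ + θ₂ * X r) ≠ ⊤) ∧
      Integrable (fun r => (conjβ β r (θ₁ + θ₂ * X r)).toReal) μ := by
  obtain ⟨hfin, hint⟩ := beta_density_integrable hst
  have hL : Integrable (fun r => p₀ r * (θ₁ + θ₂ * X r) - (β r (p₀ r)).toReal) μ := by
    have := ((hst.dens₀.integrable.const_mul θ₁).add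
      ((integrable_payoff_density hst).const_mul θ₂)).sub hint
    refine this.congr (Eventually.of_forall fun r => ?_)
    simp only [Pi.sub_apply, Pi.add_apply]
    ring
  exact integrable_toReal_of_eInt_lt_top
    (measurable_conjβ_comp hst ((hst.Xmeas.const_mul θ₂).const_add θ₁)) hL
    (hfin.mono fun r hr => le_conjβ hst hr _) hK

theorem Kfun_eq_integral (hst : Standing μ β β' X p₀ b₀) {θ₁ θ₂ : ℝ}
    (hK : Kfun μ β X θ₁ θ₂ < ⊤) :
    Kfun μ β X θ₁ θ₂ = ((∫ r, (conjβ β r (θ₁ + θ₂ * X r)).toReal ∂μ : ℝ) : EReal) := by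
  obtain ⟨hfin, hint⟩ := conjβ_integrable_of_Kfun_lt_top hst hK
  rw [← eInt_coe hint]
  exact eInt_congr_ae (hfin.mono fun r hr => (coe_toReal_conjβ hst hr).symm)

theorem Kfun_mono_left (hst : Standing μ β β' X p₀ b₀) (θ₂ : ℝ) :
    Monotone fun θ₁ => Kfun μ β X θ₁ θ₂ := fun θ₁ θ₁' h =>
  eInt_mono_ae (Eventually.of_forall fun r => conjβ_mono hst r (by linarith))

theorem Kfun_segment_lt_top (hst : Standing μ β β' X p₀ b₀) {θ₁ θ₂ u v ε : ℝ}
    (hK : Kfun μ β X θ₁ θ₂ < ⊤) (hK' : Kfun μ β X (θ₁ + u) (θ₂ + v) < ⊤)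
    (h0 : 0 ≤ ε) (h1 : ε ≤ 1) : Kfun μ β X (θ₁ + ε * u) (θ₂ + ε * v) < ⊤ := by
  obtain ⟨hfin, hint⟩ := conjβ_integrable_of_Kfun_lt_top hst hK
  obtain ⟨hfin', hint'⟩ := conjβ_integrable_of_Kfun_lt_top hst hK'
  refine lt_of_le_of_lt (eInt_mono_ae ?_)
    ((eInt_coe (hint.add ((hint'.sub hint).const_mul ε))).trans_lt (EReal.coe_lt_top _))
  filter_upwards [hfin, hfin'] with r hr hr'
  simp only [Pi.add_apply, Pi.sub_apply]
  rw [show θ₁ + u + (θ₂ + v) * X r = θ₁ + θ₂ * X r + (u + v * X r) by ring] at hr' ⊢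
  rw [show θ₁ + ε * u + (θ₂ + ε * v) * X r = θ₁ + θ₂ * X r + ε * (u + v * X r) by ring]
  obtain ⟨hne, hle⟩ := conjβ_segment_ne_top hst hr hr' h0 h1
  rw [← coe_toReal_conjβ hst hne, EReal.coe_le_coe_iff]
  exact hle

theorem Kfun_lt_top_of_mem_Theta2 {t : ℝ} (ht : t ∈ Theta2 μ β X) :
    ∃ θ₁, Kfun μ β X θ₁ t < ⊤ := by
  obtain ⟨θ₁, h⟩ := iInf_lt_iff.1 (show Gfun μ β X t < ⊤ from ht)
  refine ⟨θ₁, lt_top_iff_ne_top.2 fun hK => ?_⟩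
  simp [hK] at h

theorem convexOn_beta (hst : Standing μ β β' X p₀ b₀) (r : Ω) :
    ConvexOn ℝ {s | β r s ≠ ⊤} (fun s => (β r s).toReal) := by
  have hnonneg : ∀ s : ℝ, β r s ≠ ⊤ → 0 ≤ s := fun s hs => by
    by_contra! hlt
    exact hs (hst.betaNeg r s hlt)
  have hlim : ∀ s : ℝ, β r s ≠ ⊤ → Tendsto (fun δ : ℝ => (β r (s + δ)).toReal) (𝓝[>] 0)
      (𝓝 (β r s).toReal) := fun s hs => by
    refine (tendsto_toReal_beta hst (hnonneg s hs) hs).comp (tendsto_nhdsWithin_iff.2 ⟨?_, ?_⟩)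
    · have : Tendsto (fun δ : ℝ => s + δ) (𝓝 0) (𝓝 (s + 0)) :=
        (continuous_const.add continuous_id).tendsto 0
      simpa using this.mono_left nhdsWithin_le_nhds
    · filter_upwards [self_mem_nhdsWithin] with δ hδ
      simpa using hδ
  have hdom : Convex ℝ {s | β r s ≠ ⊤} := by
    by_cases h0 : β r 0 = ⊤
    · suffices h : {s | β r s ≠ ⊤} = Ioi 0 from h ▸ convex_Ioi 0
      ext s
      refine ⟨fun hs => (hnonneg s hs).lt_of_ne ?_, fun hs => hst.betaFin r s hs⟩
      rintro rfl
      exact hs h0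
    · suffices h : {s | β r s ≠ ⊤} = Ici 0 from h ▸ convex_Ici 0
      ext s
      refine ⟨fun hs => hnonneg s hs, fun hs => ?_⟩
      rcases (show (0 : ℝ) ≤ s from hs).eq_or_lt with rfl | hs
      exacts [h0, hst.betaFin r s hs]
  refine ⟨hdom, fun x hx y hy a b ha hb hab => ?_⟩
  have hx' := hnonneg x hx
  have hy' := hnonneg y hy
  have hxy := hdom hx hy ha hb hab
  simp only [smul_eq_mul] at hxy ⊢
  refine le_of_tendsto_of_tendsto (hlim (a * x + b * y) hxy)
    (((hlim x hx).const_mul a).add ((hlim y hy).const_mul b)) ?_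
  filter_upwards [self_mem_nhdsWithin] with δ hδ
  have hδ' : (0 : ℝ) < δ := hδ
  have h := (hst.betaConv r).convexOn.2 (show x + δ ∈ Ioi (0 : ℝ) from by simp; linarith)
    (show y + δ ∈ Ioi (0 : ℝ) from by simp; linarith) ha hb hab
  simp only [smul_eq_mul] at h
  rwa [show a * (x + δ) + b * (y + δ) = a * x + b * y + δ by
    linear_combination δ * hab] at h

theorem exists_decrease_set [SigmaFinite μ] (hst : Standing μ β β' X p₀ b₀) {c h : ℝ}
    (hc : ¬ ∀ᵐ r ∂μ, 0 < p₀ r + h →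
      (β r (p₀ r)).toReal + c * h ≤ (β r (p₀ r + h)).toReal) :
    ∃ δ : ℝ, 0 < δ ∧ ∃ B, MeasurableSet B ∧ 0 < μ B ∧ μ B < ⊤ ∧ ∀ r ∈ B, 0 < p₀ r + h ∧
      (β r (p₀ r + h)).toReal ≤ (β r (p₀ r)).toReal + (c * h - δ) := by
  let S : ℕ → Set Ω := fun m => {r | 0 < p₀ r + h} ∩ {r | (β r (max 0 (p₀ r + h))).toReal ≤
    (β r (p₀ r)).toReal + (c * h - 1 / ((m : ℝ) + 1))}
  have hSm : ∀ m, MeasurableSet (S m) := fun m =>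
    (measurableSet_lt measurable_const (hst.dens₀.1.add_const h)).inter
      (measurableSet_le
        (measurable_beta_comp hst (measurable_const.max (hst.dens₀.1.add_const h))
          fun _ => le_max_left _ _).ereal_toReal
        ((measurable_beta_comp hst hst.dens₀.1 hst.dens₀.2.1).ereal_toReal.add_const _))
  obtain ⟨m, hm⟩ : ∃ m, μ (S m) ≠ 0 := by
    by_contra! hnull
    refine hc ?_
    filter_upwards [ae_all_iff.2 fun m => measure_eq_zero_iff_ae_notMem.1 (hnull m)] with r hr hpos
    by_contra! hlt
    obtain ⟨m, hm⟩ := exists_nat_one_div_lt (sub_pos.2 hlt)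
    refine hr m ⟨hpos, ?_⟩
    simp only [mem_ofPred_eq, max_eq_right hpos.le]
    linarith
  obtain ⟨B, hB, hBS, hB0, hBtop⟩ :=
    Measure.exists_subset_measure_lt_top (hSm m) (pos_iff_ne_zero.2 hm)
  refine ⟨1 / ((m : ℝ) + 1), by positivity, B, hB, hB0, hBtop, fun r hr => ?_⟩
  obtain ⟨h1, h2⟩ := hBS hr
  have h1' : 0 < p₀ r + h := h1
  refine ⟨h1', ?_⟩
  simpa only [mem_ofPred_eq, max_eq_right h1'.le] using h2

theorem no_mass_transfer_decrease (hst : Standing μ β β' X p₀ b₀) {c h h' δ δ' : ℝ}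
    {A B : Set Ω} (hh : 0 < h) (hh' : h' < 0) (hδ : 0 < δ) (hδ' : 0 < δ')
    (hA : MeasurableSet A) (hA0 : 0 < μ A) (hAtop : μ A < ⊤)
    (hB : MeasurableSet B) (hB0 : 0 < μ B) (hBtop : μ B < ⊤)
    (hBdec : ∀ r ∈ B, 0 < p₀ r + h ∧
      (β r (p₀ r + h)).toReal ≤ (β r (p₀ r)).toReal + (c * h - δ))
    (hAdec : ∀ r ∈ A, 0 < p₀ r + h' ∧
      (β r (p₀ r + h')).toReal ≤ (β r (p₀ r)).toReal + (c * h' - δ')) : False := by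
  obtain ⟨hfin, hint⟩ := beta_density_integrable hst
  have hmA : 0 < μ.real A := ENNReal.toReal_pos hA0.ne' hAtop.ne
  have hmB : 0 < μ.real B := ENNReal.toReal_pos hB0.ne' hBtop.ne
  set P : ℝ := h * μ.real B with hP
  set Q : ℝ := -h' * μ.real A with hQ
  have hP0 : 0 < P := by positivity
  have hQ0 : 0 < Q := mul_pos (neg_pos.2 hh') hmA
  set a : ℝ := Q / (P + Q) with ha
  set b : ℝ := P / (P + Q) with hb
  have ha0 : 0 < a := by positivity
  have hb0 : 0 < b := by positivity
  have hab : a + b = 1 := by rw [ha, hb]; field_simp; ring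
  have hbal : a * (h * μ.real B) + b * (h' * μ.real A) = 0 := by
    have : h' * μ.real A = -Q := by rw [hQ]; ring
    rw [this, ← hP, ha, hb]; field_simp; ring
  have hindInt : ∀ {S : Set Ω} (x : ℝ), MeasurableSet S → μ S < ⊤ →
      Integrable (S.indicator fun _ => x) μ := fun x hS hS' =>
    (integrable_indicator_iff hS).2 (integrableOn_const hS'.ne)
  have hindEq : ∀ {S : Set Ω} (x : ℝ), MeasurableSet S →
      ∫ r, S.indicator (fun _ => x) r ∂μ = x * μ.real S := fun x hS => by
    rw [integral_indicator_const x hS, smul_eq_mul, mul_comm]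
  have hshift : ∀ {S : Set Ω} {k η : ℝ}, (∀ r ∈ S, 0 < p₀ r + k ∧
      (β r (p₀ r + k)).toReal ≤ (β r (p₀ r)).toReal + η) → ∀ r, 0 ≤ p₀ r + S.indicator (fun _ => k) r
      ∧ (β r (p₀ r) ≠ ⊤ → β r (p₀ r + S.indicator (fun _ => k) r) ≠ ⊤ ∧
        (β r (p₀ r + S.indicator (fun _ => k) r)).toReal ≤
          (β r (p₀ r)).toReal + S.indicator (fun _ => η) r) := by
    intro S k η hS r
    by_cases hr : r ∈ S
    · simp only [indicator_of_mem hr]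
      exact ⟨(hS r hr).1.le, fun _ => ⟨hst.betaFin r _ (hS r hr).1, (hS r hr).2⟩⟩
    · simp only [indicator_of_notMem hr, add_zero]
      exact ⟨hst.dens₀.2.1 r, fun hr => ⟨hr, le_rfl⟩⟩
  let pB : Ω → ℝ := fun r => p₀ r + B.indicator (fun _ => h) r
  let pA : Ω → ℝ := fun r => p₀ r + A.indicator (fun _ => h') r
  have hpm : Measurable fun r => a * pB r + b * pA r :=
    ((hst.dens₀.1.add (measurable_const.indicator hB)).const_mul a).add
      ((hst.dens₀.1.add (measurable_const.indicator hA)).const_mul b)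
  have hp0 : ∀ r, 0 ≤ a * pB r + b * pA r := fun r =>
    add_nonneg (mul_nonneg ha0.le (hshift hBdec r).1) (mul_nonneg hb0.le (hshift hAdec r).1)
  have hcombo : ∀ {f : Ω → ℝ} (x y : ℝ), Integrable f μ →
      Integrable (fun r => a * (f r + B.indicator (fun _ => x) r) +
        b * (f r + A.indicator (fun _ => y) r)) μ ∧
      ∫ r, (a * (f r + B.indicator (fun _ => x) r) + b * (f r + A.indicator (fun _ => y) r)) ∂μ =
        ∫ r, f r ∂μ + (a * (x * μ.real B) + b * (y * μ.real A)) := by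
    intro f x y hf
    have hiB : Integrable (fun r => f r + B.indicator (fun _ => x) r) μ :=
      hf.add (hindInt x hB hBtop)
    have hiA : Integrable (fun r => f r + A.indicator (fun _ => y) r) μ :=
      hf.add (hindInt y hA hAtop)
    refine ⟨(hiB.const_mul a).add (hiA.const_mul b), ?_⟩
    rw [integral_add (hiB.const_mul a) (hiA.const_mul b), integral_const_mul, integral_const_mul,
      integral_add hf (hindInt x hB hBtop), integral_add hf (hindInt y hA hAtop),
      hindEq x hB, hindEq y hA]
    linear_combination (∫ r, f r ∂μ) * hab
  have hdens : IsDensity μ fun r => a * pB r + b * pA r := by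
    refine ⟨hpm, hp0, ?_⟩
    obtain ⟨hi, he⟩ := hcombo h h' hst.dens₀.integrable
    rw [← ofReal_integral_eq_lintegral_ofReal hi (Eventually.of_forall hp0), he, hbal,
      hst.dens₀.integral_eq_one, add_zero, ENNReal.ofReal_one]
  obtain ⟨hi, he⟩ := hcombo (c * h - δ) (c * h' - δ') hint
  have hle := eInt_mono_ae (μ := μ) (f := fun r => β r (a * pB r + b * pA r))
    (g := fun r => ((a * ((β r (p₀ r)).toReal + B.indicator (fun _ => c * h - δ) r) +
      b * ((β r (p₀ r)).toReal + A.indicator (fun _ => c * h' - δ') r) : ℝ) : EReal)) (by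
    filter_upwards [hfin] with r hr
    obtain ⟨hB1, hB2⟩ := (hshift hBdec r).2 hr
    obtain ⟨hA1, hA2⟩ := (hshift hAdec r).2 hr
    have hne : β r (a * pB r + b * pA r) ≠ ⊤ :=
      (convexOn_beta hst r).1 hB1 hA1 ha0.le hb0.le hab
    rw [← EReal.coe_toReal hne (hst.betaNeBot r _)]
    refine EReal.coe_le_coe_iff.2 (((convexOn_beta hst r).2 hB1 hA1 ha0.le hb0.le hab).trans ?_)
    simp only [smul_eq_mul]
    gcongr)
  rw [eInt_coe hi, he, integral_beta_density hst] at hle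
  have hneg := EReal.coe_le_coe_iff.1 ((hst.Hnonneg _ hdens).trans hle)
  have : a * ((c * h - δ) * μ.real B) + b * ((c * h' - δ') * μ.real A) =
      -(a * δ * μ.real B + b * δ' * μ.real A) := by linear_combination c * hbal
  rw [this] at hneg
  have : 0 < a * δ * μ.real B + b * δ' * μ.real A := by positivity
  linarith

theorem exists_multiplier (hst : Standing μ β β' X p₀ b₀) :
    ∃ c : ℝ, ∀ᵐ r ∂μ, ∀ s : ℝ, 0 < s →
      s * c - (β r s).toReal ≤ p₀ r * c - (β r (p₀ r)).toReal := by
  have := hst.sigma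
  let W : ℝ → Set ℝ := fun σ => {c | ∀ᵐ r ∂μ, ∀ n : ℕ, 0 < p₀ r + σ / ((n : ℝ) + 1) →
    (β r (p₀ r)).toReal + c * (σ / ((n : ℝ) + 1)) ≤ (β r (p₀ r + σ / ((n : ℝ) + 1))).toReal}
  have hclosed : ∀ σ, IsClosed (W σ) := fun σ => by
    refine IsSeqClosed.isClosed fun x c hx hlim => ?_
    filter_upwards [ae_all_iff.2 hx] with r hr n hn
    exact le_of_tendsto' (tendsto_const_nhds.add (hlim.mul_const _)) fun k => hr k n hn
  have hcover : ∀ c, c ∈ W 1 ∨ c ∈ W (-1) := by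
    intro c
    by_contra! hcon
    obtain ⟨h1, h2⟩ := hcon
    simp only [W, mem_ofPred_eq, ae_all_iff, not_forall] at h1 h2
    obtain ⟨n, hn⟩ := h1
    obtain ⟨m, hm⟩ := h2
    obtain ⟨δ, hδ, B, hB, hB0, hBtop, hBdec⟩ := exists_decrease_set hst hn
    obtain ⟨δ', hδ', A, hA, hA0, hAtop, hAdec⟩ := exists_decrease_set hst hm
    exact no_mass_transfer_decrease hst (by positivity) (div_neg_of_neg_of_pos (by norm_num)
      (by positivity)) hδ hδ' hA hA0 hAtop hB hB0 hBtop hBdec hAdec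
  have hpos : ¬ ∀ᵐ r ∂μ, p₀ r ≤ 0 := fun h => by
    have : ∫ r, p₀ r ∂μ = 0 := integral_eq_zero_of_ae
      (h.mono fun r hr => le_antisymm hr (hst.dens₀.2.1 r))
    rw [hst.dens₀.integral_eq_one] at this
    exact one_ne_zero this
  have hne1 : (W 1).Nonempty := by
    by_contra! hempty
    have hall : ∀ k : ℕ, -(k : ℝ) ∈ W (-1) := fun k => (hcover _).resolve_left (by simp [hempty])
    refine hpos ?_
    filter_upwards [ae_all_iff.2 hall] with r hr
    by_contra! hr0
    obtain ⟨n, hn⟩ := exists_nat_one_div_lt hr0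
    obtain ⟨k, hk⟩ := exists_nat_gt (((β r (p₀ r + -1 / ((n : ℝ) + 1))).toReal -
      (β r (p₀ r)).toReal) / (1 / ((n : ℝ) + 1)))
    have h := hr k n (by rw [neg_div]; linarith)
    rw [div_lt_iff₀ (by positivity)] at hk
    rw [show -(k : ℝ) * (-1 / ((n : ℝ) + 1)) = k * (1 / ((n : ℝ) + 1)) by ring] at h
    linarith
  have hne2 : (W (-1)).Nonempty := by
    by_contra! hempty
    have hall : ∀ k : ℕ, (k : ℝ) ∈ W 1 := fun k => (hcover _).resolve_right (by simp [hempty])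
    refine hpos ?_
    filter_upwards [ae_all_iff.2 hall] with r hr
    obtain ⟨k, hk⟩ := exists_nat_gt ((β r (p₀ r + 1 / (((0 : ℕ) : ℝ) + 1))).toReal -
      (β r (p₀ r)).toReal)
    have h := hr k 0 (by have := hst.dens₀.2.1 r; positivity)
    have h1 : (1 : ℝ) / (((0 : ℕ) : ℝ) + 1) = 1 := by norm_num
    rw [h1] at h hk
    linarith
  obtain ⟨c, -, hc1, hc2⟩ := isPreconnected_closed_iff.1 isPreconnected_univ (W 1) (W (-1))
    (hclosed 1) (hclosed (-1)) (fun c _ => hcover c) (by simpa using hne1) (by simpa using hne2)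
  refine ⟨c, ?_⟩
  filter_upwards [hc1, hc2, (beta_density_integrable hst).1] with r h1 h2 hfin s hs
  have key : ∀ h l : ℝ, 0 < l → l ≤ 1 → h = l * (s - p₀ r) →
      (0 < p₀ r + h → (β r (p₀ r)).toReal + c * h ≤ (β r (p₀ r + h)).toReal) →
      s * c - (β r s).toReal ≤ p₀ r * c - (β r (p₀ r)).toReal := by
    intro h l hl hl1 heq hstep
    have hp := hst.dens₀.2.1 r
    have hpt : (1 - l) * p₀ r + l * s = p₀ r + h := by rw [heq]; ring
    have hpos : 0 < p₀ r + h := by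
      rw [← hpt]
      exact add_pos_of_nonneg_of_pos (mul_nonneg (sub_nonneg.2 hl1) hp) (mul_pos hl hs)
    have hconv := (convexOn_beta hst r).2 hfin (hst.betaFin r s hs) (sub_nonneg.2 hl1) hl.le
      (sub_add_cancel 1 l)
    simp only [smul_eq_mul, hpt] at hconv
    have := hstep hpos
    rw [heq] at this hconv
    have : l * (s * c - (β r s).toReal) ≤ l * (p₀ r * c - (β r (p₀ r)).toReal) := by linarith
    exact le_of_mul_le_mul_left this hl
  rcases lt_trichotomy s (p₀ r) with hlt | rfl | hlt
  · obtain ⟨n, hn⟩ := exists_nat_one_div_lt (sub_pos.2 hlt)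
    have hd := sub_pos.2 hlt
    refine key (-1 / ((n : ℝ) + 1)) (1 / ((n : ℝ) + 1) / (p₀ r - s)) (by positivity)
      ((div_le_one hd).2 hn.le) ?_ (h2 n)
    field_simp
    ring
  · exact le_rfl
  · obtain ⟨n, hn⟩ := exists_nat_one_div_lt (sub_pos.2 hlt)
    have hd := sub_pos.2 hlt
    refine key (1 / ((n : ℝ) + 1)) (1 / ((n : ℝ) + 1) / (s - p₀ r)) (by positivity)
      ((div_le_one hd).2 hn.le) ?_ (h1 n)
    field_simp

theorem exists_Kfun_zero_lt_top (hst : Standing μ β β' X p₀ b₀) :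
    ∃ c, Kfun μ β X c 0 < ⊤ := by
  obtain ⟨c, hc⟩ := exists_multiplier hst
  refine ⟨c, lt_of_le_of_lt (eInt_mono_ae ?_) ((eInt_coe ((hst.dens₀.integrable.mul_const c).sub
    (beta_density_integrable hst).2)).trans_lt (EReal.coe_lt_top _))⟩
  filter_upwards [hc] with r hr
  rw [zero_mul, add_zero]
  exact conjβ_le hst fun s hs => EReal.coe_le_coe_iff.2 (hr s hs)

theorem Gfun_le_of_Kfun_lt_top (hst : Standing μ β β' X p₀ b₀) {θ₁ θ₂ : ℝ}
    (hK : Kfun μ β X θ₁ θ₂ < ⊤) :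
    Gfun μ β X θ₂ ≤ ((∫ r, (conjβ β r (θ₁ + θ₂ * X r)).toReal ∂μ - θ₁ : ℝ) : EReal) := by
  rw [EReal.coe_sub, ← Kfun_eq_integral hst hK]
  exact iInf_le (fun θ₁ : ℝ => Kfun μ β X θ₁ θ₂ - (θ₁ : EReal)) θ₁

theorem le_Gfun_of_forall_integral (hst : Standing μ β β' X p₀ b₀) {θ₂ x : ℝ}
    (h : ∀ θ₁, Kfun μ β X θ₁ θ₂ < ⊤ → x ≤ ∫ r, (conjβ β r (θ₁ + θ₂ * X r)).toReal ∂μ - θ₁) :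
    (x : EReal) ≤ Gfun μ β X θ₂ := by
  refine le_iInf fun θ₁ => ?_
  rcases eq_or_ne (Kfun μ β X θ₁ θ₂) ⊤ with hK | hK
  · simp [hK]
  · rw [Kfun_eq_integral hst hK.lt_top, ← EReal.coe_sub]
    exact EReal.coe_le_coe_iff.2 (h θ₁ hK.lt_top)

theorem Kfun_lt_top_of_eq_Gfun {θ₁ θ₂ : ℝ} (hmem : θ₂ ∈ Theta2 μ β X)
    (h : Kfun μ β X θ₁ θ₂ - (θ₁ : EReal) = Gfun μ β X θ₂) : Kfun μ β X θ₁ θ₂ < ⊤ := by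
  refine lt_top_iff_ne_top.2 fun hK => ?_
  have hG : Gfun μ β X θ₂ < ⊤ := hmem
  rw [← h, hK] at hG
  simp at hG

theorem ae_lt_derivTop_of_eq_Gfun (hst : Standing μ β β' X p₀ b₀) {θ₁ θ₂ : ℝ}
    (hmem : θ₂ ∈ Theta2 μ β X)
    (h : Kfun μ β X θ₁ θ₂ - (θ₁ : EReal) = Gfun μ β X θ₂) :
    ∀ᵐ r ∂μ, ((θ₁ + θ₂ * X r : ℝ) : EReal) < derivTop β' r := by
  have hK := Kfun_lt_top_of_eq_Gfun hmem h
  obtain ⟨hfin, hint⟩ := conjβ_integrable_of_Kfun_lt_top hst hK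
  have hshift : ∀ ε r : ℝ, θ₁ + θ₂ * r - ε = (θ₁ - ε) + θ₂ * r := fun ε r => by ring
  have hKε : ∀ ε : ℝ, 0 < ε → Kfun μ β X (θ₁ - ε) θ₂ < ⊤ := fun ε hε =>
    (Kfun_mono_left hst θ₂ (sub_le_self θ₁ hε.le)).trans_lt hK
  refine ae_lt_derivTop_of_integral_le hst ((hst.Xmeas.const_mul θ₂).const_add θ₁) hfin hint
    (fun ε hε => ?_) fun ε hε => ?_
  · simp only [hshift]
    exact (conjβ_integrable_of_Kfun_lt_top hst (hKε ε hε)).2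
  · have hle := Gfun_le_of_Kfun_lt_top hst (hKε ε hε)
    rw [← h, Kfun_eq_integral hst hK, ← EReal.coe_sub, EReal.coe_le_coe_iff] at hle
    simp only [hshift]
    linarith

theorem aemeasurable_conjβ_deriv (hst : Standing μ β β' X p₀ b₀) {T q : Ω → ℝ}
    (hT : Measurable T)
    (hq : ∀ᵐ r ∂μ, HasDerivAt (fun t => (conjβ β r t).toReal) (q r) (T r)) :
    AEMeasurable q μ := by
  refine aemeasurable_of_tendsto_metrizable_ae (𝓝[>] (0 : ℝ))
    (f := fun (ε : ℝ) r => ((conjβ β r (T r + ε * 1)).toReal - (conjβ β r (T r)).toReal) / ε)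
    (fun ε => ?_) ?_
  · exact (((measurable_conjβ_comp hst (hT.add_const _)).ereal_toReal.sub
      (measurable_conjβ_comp hst hT).ereal_toReal).div_const ε).aemeasurable
  · filter_upwards [hq] with r hr
    simpa using tendsto_conjβ_quotient hr 1

theorem ae_mul_le_conjβ_quotient (hst : Standing μ β β' X p₀ b₀) {q : Ω → ℝ}
    {θ₁ θ₂ u v : ℝ} (hK : Kfun μ β X θ₁ θ₂ < ⊤) (hK' : Kfun μ β X (θ₁ + u) (θ₂ + v) < ⊤)
    (hq : ∀ᵐ r ∂μ, HasDerivAt (fun t => (conjβ β r t).toReal) (q r) (θ₁ + θ₂ * X r)) :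
    ∀ᵐ r ∂μ, u * q r + v * (X r * q r) ≤
      (conjβ β r (θ₁ + u + (θ₂ + v) * X r)).toReal - (conjβ β r (θ₁ + θ₂ * X r)).toReal := by
  filter_upwards [(conjβ_integrable_of_Kfun_lt_top hst hK).1,
    (conjβ_integrable_of_Kfun_lt_top hst hK').1, hq] with r hr hr' hqr
  rw [show θ₁ + u + (θ₂ + v) * X r = θ₁ + θ₂ * X r + (u + v * X r) by ring] at hr' ⊢
  linarith [mul_le_conjβ_quotient hst hr hr' hqr]

theorem integrable_payoff_conjβ_deriv (hst : Standing μ β β' X p₀ b₀) {q : Ω → ℝ}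
    {θ₁ θ₂ u v u' v' : ℝ} (hK : Kfun μ β X θ₁ θ₂ < ⊤)
    (hq : ∀ᵐ r ∂μ, HasDerivAt (fun t => (conjβ β r t).toReal) (q r) (θ₁ + θ₂ * X r))
    (hqint : Integrable q μ) (hv : 0 < v) (hKv : Kfun μ β X (θ₁ + u) (θ₂ + v) < ⊤)
    (hv' : v' < 0) (hKv' : Kfun μ β X (θ₁ + u') (θ₂ + v') < ⊤) :
    Integrable (fun r => X r * q r) μ := by
  have hI : ∀ {a b : ℝ}, Kfun μ β X (θ₁ + a) (θ₂ + b) < ⊤ → Integrable (fun r =>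
      (((conjβ β r (θ₁ + a + (θ₂ + b) * X r)).toReal - (conjβ β r (θ₁ + θ₂ * X r)).toReal) -
        a * q r) / b) μ := fun h =>
    (((conjβ_integrable_of_Kfun_lt_top hst h).2.sub
      (conjβ_integrable_of_Kfun_lt_top hst hK).2).sub (hqint.const_mul _)).div_const _
  refine ((hI hKv).abs.add (hI hKv').abs).mono'
    (hst.Xmeas.aestronglyMeasurable.mul hqint.aestronglyMeasurable) ?_
  filter_upwards [ae_mul_le_conjβ_quotient hst hK hKv hq,
    ae_mul_le_conjβ_quotient hst hK hKv' hq] with r h h'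
  refine (abs_le_max_abs_abs ((div_le_iff_of_neg hv').2 ?_) ((le_div_iff₀ hv).2 ?_)).trans
    ((max_le_add_of_nonneg (abs_nonneg _) (abs_nonneg _)).trans (add_comm _ _).le)
  · linarith
  · linarith

theorem integral_affine_mul {q : Ω → ℝ} (hqint : Integrable q μ) (hq1 : ∫ r, q r ∂μ = 1)
    (hXq : Integrable (fun r => X r * q r) μ) (u v : ℝ) :
    ∫ r, (u * q r + v * (X r * q r)) ∂μ = u + (∫ r, X r * q r ∂μ) * v := by
  rw [integral_add (hqint.const_mul u) (hXq.const_mul v), integral_const_mul, integral_const_mul,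
    hq1, mul_one, mul_comm v]

theorem add_mul_le_Gfun (hst : Standing μ β β' X p₀ b₀) {q : Ω → ℝ} {θ₁ θ₂ : ℝ}
    (hK : Kfun μ β X θ₁ θ₂ < ⊤)
    (hq : ∀ᵐ r ∂μ, HasDerivAt (fun t => (conjβ β r t).toReal) (q r) (θ₁ + θ₂ * X r))
    (hqint : Integrable q μ) (hq1 : ∫ r, q r ∂μ = 1)
    (hXq : Integrable (fun r => X r * q r) μ) (v : ℝ) :
    ((∫ r, (conjβ β r (θ₁ + θ₂ * X r)).toReal ∂μ - θ₁ + (∫ r, X r * q r ∂μ) * v : ℝ) : EReal)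
      ≤ Gfun μ β X (θ₂ + v) := by
  refine le_Gfun_of_forall_integral hst fun s hs => ?_
  obtain ⟨u, rfl⟩ : ∃ u, s = θ₁ + u := ⟨s - θ₁, by ring⟩
  have hi := (conjβ_integrable_of_Kfun_lt_top hst hK).2
  have hi' := (conjβ_integrable_of_Kfun_lt_top hst hs).2
  have h := integral_mono_ae ((hqint.const_mul u).add (hXq.const_mul v)) (hi'.sub hi)
    (ae_mul_le_conjβ_quotient hst hK hs hq)
  simp only [Pi.add_apply, Pi.sub_apply] at h
  rw [integral_sub hi' hi, integral_affine_mul hqint hq1 hXq] at h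
  linarith

theorem tendsto_slope_Gfun_ray (hst : Standing μ β β' X p₀ b₀) {q : Ω → ℝ} {θ₁ θ₂ u v : ℝ}
    (hmin : Kfun μ β X θ₁ θ₂ - (θ₁ : EReal) = Gfun μ β X θ₂)
    (hK : Kfun μ β X θ₁ θ₂ < ⊤) (hv : v ≠ 0) (hK' : Kfun μ β X (θ₁ + u) (θ₂ + v) < ⊤)
    (hq : ∀ᵐ r ∂μ, HasDerivAt (fun t => (conjβ β r t).toReal) (q r) (θ₁ + θ₂ * X r))
    (hqint : Integrable q μ) (hq1 : ∫ r, q r ∂μ = 1)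
    (hXq : Integrable (fun r => X r * q r) μ) :
    Tendsto (fun ε => slope (fun t => (Gfun μ β X t).toReal) θ₂ (θ₂ + ε * v)) (𝓝[>] 0)
      (𝓝 (∫ r, X r * q r ∂μ)) := by
  have hG : Gfun μ β X θ₂ =
      ((∫ r, (conjβ β r (θ₁ + θ₂ * X r)).toReal ∂μ - θ₁ : ℝ) : EReal) := by
    rw [← hmin, Kfun_eq_integral hst hK, EReal.coe_sub]
  have hKε : ∀ ε : ℝ, 0 ≤ ε → ε ≤ 1 → Kfun μ β X (θ₁ + ε * u) (θ₂ + ε * v) < ⊤ :=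
    fun ε h0 h1 => Kfun_segment_lt_top hst hK hK' h0 h1
  have hshift : ∀ ε x : ℝ,
      θ₁ + ε * u + (θ₂ + ε * v) * x = θ₁ + θ₂ * x + ε * (u + v * x) := fun ε x => by ring
  have hlow : ∀ ε, _ := fun ε : ℝ => add_mul_le_Gfun hst hK hq hqint hq1 hXq (ε * v)
  have hup : ∀ ε : ℝ, 0 ≤ ε → ε ≤ 1 → Gfun μ β X (θ₂ + ε * v) ≤ ((∫ r, (conjβ β r
      (θ₁ + θ₂ * X r + ε * (u + v * X r))).toReal ∂μ - (θ₁ + ε * u) : ℝ) : EReal) :=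
    fun ε h0 h1 => by
      have h := Gfun_le_of_Kfun_lt_top hst (hKε ε h0 h1)
      simpa only [hshift] using h
  refine tendsto_slope_ray_of_le hv (m := fun ε =>
    ∫ r, (conjβ β r (θ₁ + θ₂ * X r + ε * (u + v * X r))).toReal ∂μ -
      ∫ r, (conjβ β r (θ₁ + θ₂ * X r)).toReal ∂μ - ε * u) (fun ε hε => ?_) (fun ε hε => ?_) ?_
  · rw [hG, EReal.toReal_coe]
    exact EReal.toReal_le_toReal (hlow ε) (EReal.coe_ne_bot _)
      ((hup ε hε.1.le hε.2).trans_lt (EReal.coe_lt_top _)).ne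
  · rw [hG, EReal.toReal_coe]
    refine (EReal.toReal_le_toReal (hup ε hε.1.le hε.2)
      ((EReal.bot_lt_coe _).trans_le (hlow ε)).ne' (EReal.coe_ne_top _)).trans ?_
    rw [EReal.toReal_coe]
    linarith
  · have hwq : ∀ r, (u + v * X r) * q r = u * q r + v * (X r * q r) := fun r => by ring
    have h := tendsto_integral_conjβ_quotient hst (w := fun r => u + v * X r)
      (conjβ_integrable_of_Kfun_lt_top hst hK).1
      ((conjβ_integrable_of_Kfun_lt_top hst hK').1.mono fun r hr => by
        rwa [show θ₁ + u + (θ₂ + v) * X r = θ₁ + θ₂ * X r + (u + v * X r) by ring] at hr)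
      (fun ε h0 h1 => by
        simpa only [hshift] using (conjβ_integrable_of_Kfun_lt_top hst (hKε ε h0 h1)).2) hq
      (((hqint.const_mul u).add (hXq.const_mul v)).congr
        (Eventually.of_forall fun r => (hwq r).symm))
    simp only [hwq] at h
    rw [integral_affine_mul hqint hq1 hXq] at h
    have h' := h.sub_const u
    rw [add_sub_cancel_left] at h'
    refine h'.congr' ?_
    filter_upwards [self_mem_nhdsWithin] with ε hε
    have hε0 : ε ≠ 0 := (show (0 : ℝ) < ε from hε).ne'
    rw [sub_div _ (ε * u), mul_div_cancel_left₀ _ hε0]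

end Conjugate

/-- Corollary on differentiability of `G`. The function `G` is
differentiable at each `θ₂ ∈ (θ_min, 0)` for which `q_{θ₂}` is a density. Here
`θ₂ > θ_min` is expressed by the existence of some `t ∈ Θ₂` with `t < θ₂`, and
`q_{θ₂} = p_{θb₁,θ₂}` with `θb₁` the unique minimiser of `θ₁ ↦ K(θ₁,θ₂) − θ₁`. -/
theorem G_differentiable {Ω : Type*} [MeasurableSpace Ω] (μ : Measure Ω)
    (β : Ω → ℝ → EReal) (β' : Ω → ℝ → ℝ) (ψ : Ω → ℝ → ℝ) (X : Ω → ℝ) (p₀ : Ω → ℝ) (b₀ : ℝ)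
    (hst : Standing μ β β' X p₀ b₀) (hψ : IsConjDeriv β β' ψ)
    (θ₂ : ℝ) (hθ₂neg : θ₂ < 0) (hθ₂mem : θ₂ ∈ Theta2 μ β X)
    (hgt : ∃ t ∈ Theta2 μ β X, t < θ₂)
    (θb₁ : ℝ) (hθb : Kfun μ β X θb₁ θ₂ - (θb₁ : EReal) = Gfun μ β X θ₂)
    (hθbu : ∀ θ₁ : ℝ, Kfun μ β X θ₁ θ₂ - (θ₁ : EReal) = Gfun μ β X θ₂ → θ₁ = θb₁)
    (hdens : pInt μ (pFam ψ X θb₁ θ₂) = 1) :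
    DifferentiableAt ℝ (fun t => (Gfun μ β X t).toReal) θ₂ := by
  have hK := Kfun_lt_top_of_eq_Gfun hθ₂mem hθb
  have hfin := (conjβ_integrable_of_Kfun_lt_top hst hK).1
  have hq : ∀ᵐ r ∂μ, HasDerivAt (fun t => (conjβ β r t).toReal) (pFam ψ X θb₁ θ₂ r)
      (θb₁ + θ₂ * X r) :=
    (ae_lt_derivTop_of_eq_Gfun hst hθ₂mem hθb).mono fun r hr => hψ r _ hr
  have hq0 : 0 ≤ᵐ[μ] pFam ψ X θb₁ θ₂ := by
    filter_upwards [hfin, hq] with r hr hqr using conjβ_deriv_nonneg hst hr hqr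
  have hqm := (aemeasurable_conjβ_deriv hst ((hst.Xmeas.const_mul θ₂).const_add θb₁)
    hq).aestronglyMeasurable
  have hqint : Integrable (pFam ψ X θb₁ θ₂) μ := by
    refine ⟨hqm, ?_⟩
    rw [hasFiniteIntegral_iff_ofReal hq0]
    exact hdens.trans_lt ENNReal.one_lt_top
  have hq1 : ∫ r, pFam ψ X θb₁ θ₂ r ∂μ = 1 := by
    rw [integral_eq_lintegral_of_nonneg_ae hq0 hqm]
    exact (congrArg ENNReal.toReal hdens).trans ENNReal.toReal_one
  obtain ⟨c, hc⟩ := exists_Kfun_zero_lt_top hst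
  obtain ⟨t, ht, htlt⟩ := hgt
  obtain ⟨s, hs⟩ := Kfun_lt_top_of_mem_Theta2 ht
  have hKr : Kfun μ β X (θb₁ + (c - θb₁)) (θ₂ + -θ₂) < ⊤ := by simpa using hc
  have hKl : Kfun μ β X (θb₁ + (s - θb₁)) (θ₂ + (t - θ₂)) < ⊤ := by simpa using hs
  have hr : 0 < -θ₂ := neg_pos.2 hθ₂neg
  have hl : t - θ₂ < 0 := sub_neg.2 htlt
  have hXq := integrable_payoff_conjβ_deriv hst hK hq hqint hr hKr hl hKl
  exact (hasDerivAt_of_tendsto_slope_rays hr hl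
    (tendsto_slope_Gfun_ray hst hθb hK hr.ne' hKr hq hqint hq1 hXq)
    (tendsto_slope_Gfun_ray hst hθb hK hl.ne hKl hq hqint hq1 hXq)).differentiableAt
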